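/- arXiv:1810.09223 — 2 statements merged into one kernel-verified Lean document; each statement's English description precedes it below -/
import Mathlib

section
/- Let R > 0 and let Π be a measurable real-valued function on D = {(x,y) ∈ ℝ² : 0 ≤ x ≤ y}; set Π̄(x,λ) = Π(x, λx). Assume there exist constants ε₁, ε₄, ε₅, ε₃, ε₆ with 1 ≥ ε₁ > ε₄ ≥ 0, 1 > ε₅ ≥ 0, ε₃ > ε₆ ≥ 0, constants λ₁ > 1 and 0 ≤ λ₂ < 1, a function ψ : (0,∞) → (0,∞) with ψ(T)/log T → 0 as T → ∞, and a constant c > 0 such that: (1) for every λ > 1 and all a, b > R one has |∫_a^b Π̄(x,λ) dx| ≤ c·ψ(max(a,b))·(λ^{ε₄}/|λ−1|^{ε₁} + λ^{ε₅}/|λ−λ₁| + λ^{ε₆}/|λ−λ₂|^{ε₃}); and (2) |Π(x,y)| ≤ c for all y > x > R. Then ∫∫_{{(x,y) : R ≤ x ≤ y}} |φ^{(R,T)}(x) − φ^{(R,T)}(y)|² · Π(x,y)/(y−x) dx dy → 0 as T → ∞. -/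
open MeasureTheory Filter

/-- The cutoff function `φ^{(R,T)}`: equal to `1` on `(-∞, R]`, to
`1 - log(x-R+1)/log(T-R+1)` on `[R, T]`, and to `0` on `[T, ∞)`. -/
noncomputable def phi (R T x : ℝ) : ℝ :=
  if x ≤ R then 1
  else if x ≤ T then 1 - Real.log (x - R + 1) / Real.log (T - R + 1)
  else 0

lemma aux_ordConn (f : ℝ → ℝ) (R T M : ℝ) (hM0 : 0 ≤ M)
    (hM : ∀ s t, R ≤ s → s ≤ t → t ≤ T → |∫ x in s..t, f x| ≤ M)
    (S : Set ℝ) (hS : S.OrdConnected) (hST : S ⊆ Set.Ioc R T) :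
    |∫ x in S, f x| ≤ M := by
  rcases S.eq_empty_or_nonempty with h | hne
  · simp [h, hM0]
  have hbb : BddBelow S := ⟨R, fun x hx => (hST hx).1.le⟩
  have hba : BddAbove S := ⟨T, fun x hx => (hST hx).2⟩
  have h1 : Set.Ioo (sInf S) (sSup S) ⊆ S :=
    IsConnected.Ioo_csInf_csSup_subset ⟨hne, hS.isPreconnected⟩ hbb hba
  have h2 : S ⊆ Set.Icc (sInf S) (sSup S) := subset_Icc_csInf_csSup hbb hba
  have hle : sInf S ≤ sSup S := csInf_le_csSup hne hbb hba
  have hae : S =ᵐ[volume] Set.Ioc (sInf S) (sSup S) := by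
    apply EventuallyLE.antisymm
    · exact h2.eventuallyLE.trans Ioc_ae_eq_Icc.symm.le
    · exact Ioo_ae_eq_Ioc.symm.le.trans h1.eventuallyLE
  rw [setIntegral_congr_set hae, ← intervalIntegral.integral_of_le hle]
  exact hM _ _ (le_csInf hne fun x hx => (hST hx).1.le) hle (csSup_le hne fun x hx => (hST hx).2)

lemma aux_layer (f g : ℝ → ℝ) (R T M B : ℝ) (hM0 : 0 ≤ M) (hB : 0 ≤ B)
    (hf : IntegrableOn f (Set.Ioc R T)) (hg : Measurable g)
    (hM : ∀ s t, R ≤ s → s ≤ t → t ≤ T → |∫ x in s..t, f x| ≤ M)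
    (hg0 : ∀ x ∈ Set.Ioc R T, 0 ≤ g x) (hgB : ∀ x ∈ Set.Ioc R T, g x ≤ B)
    (huni : ∀ x y z, R < x → x ≤ y → y ≤ z → z ≤ T → min (g x) (g z) ≤ g y) :
    |∫ x in Set.Ioc R T, g x * f x| ≤ B * M := by
  have key : ∀ x ∈ Set.Ioc R T, g x * f x
      = ∫ u in Set.Ioc 0 B, Set.indicator {p : ℝ × ℝ | p.2 < g p.1} (fun p => f p.1) (x, u) := by
    intro x hx
    have : ∀ u, Set.indicator {p : ℝ × ℝ | p.2 < g p.1} (fun p => f p.1) (x, u)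
        = Set.indicator (Set.Iio (g x)) (fun _ => f x) u := by
      intro u; simp [Set.indicator]
    simp_rw [this]
    rw [setIntegral_indicator measurableSet_Iio, setIntegral_const]
    have h3 : Set.Ioc 0 B ∩ Set.Iio (g x) = Set.Ioo 0 (g x) := by
      ext u; simp only [Set.mem_inter_iff, Set.mem_Ioc, Set.mem_Iio, Set.mem_Ioo]
      constructor
      · rintro ⟨⟨a, b⟩, c⟩; exact ⟨a, c⟩
      · rintro ⟨a, b⟩; exact ⟨⟨a, b.le.trans (hgB x hx)⟩, b⟩
    rw [h3]
    simp [measureReal_def, hg0 x hx]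
  rw [setIntegral_congr_fun measurableSet_Ioc key]
  have hms : MeasurableSet {p : ℝ × ℝ | p.2 < g p.1} :=
    measurableSet_lt measurable_snd (hg.comp measurable_fst)
  rw [integral_integral_swap]
  · have : ‖∫ u in Set.Ioc 0 B, ∫ x in Set.Ioc R T,
        Set.indicator {p : ℝ × ℝ | p.2 < g p.1} (fun p => f p.1) (x, u)‖
        ≤ M * volume.real (Set.Ioc 0 B) := by
      apply norm_setIntegral_le_of_norm_le_const
      · simp
      intro u hu
      have h4 : ∀ x, Set.indicator {p : ℝ × ℝ | p.2 < g p.1} (fun p => f p.1) (x, u)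
        = Set.indicator {x | u < g x} f x := by
        intro x; simp [Set.indicator]
      simp_rw [h4]
      rw [setIntegral_indicator (measurableSet_lt measurable_const hg)]
      apply aux_ordConn f R T M hM0 hM
      · constructor
        rintro x ⟨hx1, hx2⟩ z ⟨hz1, hz2⟩ y ⟨hy1, hy2⟩
        refine ⟨⟨hx1.1.trans_le hy1, hy2.trans hz1.2⟩, ?_⟩
        exact lt_of_lt_of_le (lt_min hx2 hz2) (huni x y z hx1.1 hy1 hy2 hz1.2)
      · exact Set.inter_subset_left
    simpa [measureReal_def, hB, mul_comm] using this
  · have : Integrable (fun p : ℝ × ℝ => f p.1)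
      ((volume.restrict (Set.Ioc R T)).prod (volume.restrict (Set.Ioc 0 B))) := 
      Integrable.comp_fst hf _
    exact this.indicator hms

lemma aux_swap (F : ℝ × ℝ → ℝ) (hm : Measurable F) (hF : Integrable F) :
    Integrable (fun q : ℝ => ∫ x : ℝ, |x| * F (x, x * q)) ∧
    ∫ p, F p = ∫ q : ℝ, ∫ x : ℝ, |x| * F (x, x * q) := by
  have hne : ∀ᵐ x : ℝ, x ≠ 0 := by
    simp [ae_iff]
  have hsc : ∀ (g : ℝ → ℝ) (x : ℝ), x ≠ 0 → ∫ q : ℝ, |x| * g (x * q) = ∫ y, g y := by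
    intro g x hx
    rw [integral_const_mul, Measure.integral_comp_mul_left, smul_eq_mul, abs_inv,
      mul_inv_cancel_left₀ (abs_ne_zero.mpr hx)]
  have hF' : Integrable F (volume.prod volume) := hF
  have hI : Integrable (fun p : ℝ × ℝ => |p.1| * F (p.1, p.1 * p.2)) (volume.prod volume) := by
    have hm2 : Measurable (fun p : ℝ × ℝ => |p.1| * F (p.1, p.1 * p.2)) := by fun_prop
    rw [integrable_prod_iff hm2.aestronglyMeasurable]
    have h1 := (integrable_prod_iff hF'.aestronglyMeasurable).1 hF'
    constructor
    · filter_upwards [h1.1, hne] with x hx hx0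
      exact (hx.comp_mul_left' hx0).const_mul _
    · refine h1.2.congr ?_
      filter_upwards [hne] with x hx0
      rw [← hsc _ x hx0]
      simp
  refine ⟨hI.integral_prod_right, ?_⟩
  have e1 : ∫ p, F p = ∫ x, ∫ y, F (x, y) := integral_prod F hF'
  rw [e1, integral_integral_swap (f := fun q x => |x| * F (x, x * q)) hI.swap]
  apply integral_congr_ae
  filter_upwards [hne] with x hx0
  exact (hsc (fun y => F (x, y)) x hx0).symm

lemma phi_eq (R T x : ℝ) (hT : R < T) (hx : R ≤ x) :
    phi R T x = max 0 (1 - Real.log (x - R + 1) / Real.log (T - R + 1)) := by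
  have hL : 0 < Real.log (T - R + 1) := Real.log_pos (by linarith)
  unfold phi
  split_ifs with h1 h2
  · have : x = R := le_antisymm h1 hx
    subst this; simp
  · rw [max_eq_right]
    rw [sub_nonneg, div_le_one hL]
    exact Real.log_le_log (by linarith) (by linarith)
  · rw [max_eq_left]
    rw [sub_nonpos, le_div_iff₀ hL, one_mul]
    exact Real.log_le_log (by linarith) (by linarith)

lemma phi_meas (R T : ℝ) : Measurable (phi R T) := by
  unfold phi
  refine Measurable.ite measurableSet_Iic measurable_const
    (Measurable.ite measurableSet_Iic ?_ measurable_const)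
  fun_prop

lemma phi_zero (R T x : ℝ) (hT : R < T) (hx : T ≤ x) : phi R T x = 0 := by
  have hL : 0 < Real.log (T - R + 1) := Real.log_pos (by linarith)
  rw [phi_eq R T x hT (by linarith), max_eq_left]
  rw [sub_nonpos, le_div_iff₀ hL, one_mul]
  exact Real.log_le_log (by linarith) (by linarith)

lemma phi_nonneg (R T x : ℝ) (hT : R < T) (hx : R ≤ x) : 0 ≤ phi R T x := by
  rw [phi_eq R T x hT hx]; exact le_max_left _ _

lemma phi_anti (R T x y : ℝ) (hT : R < T) (hx : R ≤ x) (hxy : x ≤ y) :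
    phi R T y ≤ phi R T x := by
  have hL : 0 < Real.log (T - R + 1) := Real.log_pos (by linarith)
  rw [phi_eq R T x hT hx, phi_eq R T y hT (hx.trans hxy)]
  have := Real.log_le_log (show 0 < x - R + 1 by linarith) (show x - R + 1 ≤ y - R + 1 by linarith)
  gcongr

/-- log of the ratio -/
lemma h_le (R T q x : ℝ) (hR : 0 < R) (hT : R < T) (hx : R ≤ x) (hq : 1 < q) :
    phi R T x - phi R T (q * x) ≤
      Real.log (1 + (q - 1) * (x / (x - R + 1))) / Real.log (T - R + 1) := by
  have hL : 0 < Real.log (T - R + 1) := Real.log_pos (by linarith)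
  have hqx : x ≤ q * x := by nlinarith
  have e : 1 + (q - 1) * (x / (x - R + 1)) = (q * x - R + 1) / (x - R + 1) := by
    have : x - R + 1 ≠ 0 := by linarith
    field_simp; ring
  rw [e, Real.log_div (by linarith) (by linarith), sub_div]
  rw [phi_eq R T x hT hx, phi_eq R T _ hT (hx.trans hqx)]
  have h1 := le_max_right 0 (1 - Real.log (q * x - R + 1) / Real.log (T - R + 1))
  have h2 : Real.log (x - R + 1) / Real.log (T - R + 1) ≤ Real.log (q * x - R + 1) / Real.log (T - R + 1) := by
    gcongr
  rcases max_cases 0 (1 - Real.log (x - R + 1) / Real.log (T - R + 1)) with h | h <;>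
  rcases max_cases 0 (1 - Real.log (q * x - R + 1) / Real.log (T - R + 1)) with h' | h' <;> linarith

lemma h_eq (R T q x : ℝ) (hR : 0 < R) (hT : R < T) (hx : R ≤ x) (hq : 1 < q) (hqT : q * x ≤ T) :
    phi R T x - phi R T (q * x) =
      Real.log (1 + (q - 1) * (x / (x - R + 1))) / Real.log (T - R + 1) := by
  have hL : 0 < Real.log (T - R + 1) := Real.log_pos (by linarith)
  have hqx : x ≤ q * x := by nlinarith
  have e : 1 + (q - 1) * (x / (x - R + 1)) = (q * x - R + 1) / (x - R + 1) := by
    have : x - R + 1 ≠ 0 := by linarith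
    field_simp; ring
  rw [e, Real.log_div (by linarith) (by linarith), sub_div]
  have h : ∀ y, R ≤ y → y ≤ T → phi R T y = 1 - Real.log (y - R + 1) / Real.log (T - R + 1) := by
    intro y hy hyT
    rw [phi_eq R T y hT hy, max_eq_right]
    rw [sub_nonneg, div_le_one hL]
    exact Real.log_le_log (by linarith) (by linarith)
  rw [h x hx (by linarith), h (q * x) (by linarith) hqT]
  ring

lemma h_uni (R T q x y z : ℝ) (hR : 0 < R) (hT : R < T) (hx : R ≤ x) (hq : 1 < q)
    (hxy : x ≤ y) (hyz : y ≤ z) :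
    min (phi R T x - phi R T (q * x)) (phi R T z - phi R T (q * z)) ≤
      phi R T y - phi R T (q * y) := by
  have hL : 0 < Real.log (T - R + 1) := Real.log_pos (by linarith)
  rcases le_total T (q * y) with h | h
  · apply min_le_of_right_le
    rw [phi_zero R T (q * y) hT h]
    have := phi_nonneg R T (q * z) hT (by nlinarith)
    have := phi_anti R T y z hT (by linarith) hyz
    linarith
  · rw [h_eq R T q y hR hT (by linarith) hq h]
    have mono : ∀ s t, R ≤ s → R ≤ t → s / (s - R + 1) ≤ t / (t - R + 1) →
        Real.log (1 + (q - 1) * (s / (s - R + 1))) / Real.log (T - R + 1) ≤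
        Real.log (1 + (q - 1) * (t / (t - R + 1))) / Real.log (T - R + 1) := by
      intro s t hs ht hst
      have : 0 ≤ (q - 1) * (s / (s - R + 1)) :=
        mul_nonneg (by linarith) (div_nonneg (by linarith) (by linarith))
      have h2 : (q - 1) * (s / (s - R + 1)) ≤ (q - 1) * (t / (t - R + 1)) :=
        mul_le_mul_of_nonneg_left hst (by linarith)
      apply div_le_div_of_nonneg_right _ hL.le
      exact Real.log_le_log (by linarith) (by linarith)
    rcases le_total R 1 with hR1 | hR1
    · apply min_le_of_left_le
      refine (h_le R T q x hR hT hx hq).trans (mono _ _ hx (by linarith) ?_)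
      rw [div_le_div_iff₀ (by linarith) (by linarith)]
      nlinarith
    · apply min_le_of_right_le
      refine (h_le R T q z hR hT (by linarith) hq).trans (mono _ _ (by linarith) (by linarith) ?_)
      rw [div_le_div_iff₀ (by linarith) (by linarith)]
      nlinarith

lemma h_bd (R T q x : ℝ) (hR : 0 < R) (hT : R < T) (hx : R ≤ x) (hq : 1 < q) :
    |phi R T x - phi R T (q * x)| ≤
      Real.log (1 + (q - 1) * max 1 R) / Real.log (T - R + 1) := by
  have hL : 0 < Real.log (T - R + 1) := Real.log_pos (by linarith)
  rw [abs_of_nonneg (sub_nonneg.2 (phi_anti R T x (q * x) hT hx (by nlinarith)))]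
  refine (h_le R T q x hR hT hx hq).trans ?_
  have h1 : 0 ≤ (q - 1) * (x / (x - R + 1)) :=
        mul_nonneg (by linarith) (div_nonneg (by linarith) (by linarith))
  apply div_le_div_of_nonneg_right _ hL.le
  apply Real.log_le_log (by linarith)
  have : x / (x - R + 1) ≤ max 1 R := by
    rw [div_le_iff₀ (by linarith)]
    rcases le_total R 1 with h | h
    · rw [max_eq_left h]; linarith
    · rw [max_eq_right h]; nlinarith
  have := mul_le_mul_of_nonneg_left this (show 0 ≤ q - 1 by linarith)
  linarith

lemma log_int (M l s : ℝ) (hl : 1 < l) (hM : l < M) (hs : 0 < s) :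
    IntegrableOn (fun q => 1 / (|q - l| + s)) (Set.Ioc 1 M) ∧
    ∫ q in Set.Ioc 1 M, 1 / (|q - l| + s) ≤ 2 * Real.log (1 + M / s) := by
  have hc : Continuous (fun q => 1 / (|q - l| + s)) := by
    apply Continuous.div continuous_const (by fun_prop)
    intro q; positivity
  refine ⟨hc.integrableOn_Ioc, ?_⟩
  rw [← intervalIntegral.integral_of_le (by linarith),
    ← intervalIntegral.integral_add_adjacent_intervals (hc.intervalIntegrable 1 l)
      (hc.intervalIntegrable l M)]
  have e1 : ∫ q in (1:ℝ)..l, 1 / (|q - l| + s) = Real.log (l - 1 + s) - Real.log s := by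
    have := intervalIntegral.integral_eq_sub_of_hasDerivAt (a := 1) (b := l)
      (f := fun q => - Real.log (l - q + s)) (f' := fun q => 1 / (|q - l| + s)) ?_
      (hc.intervalIntegrable _ _)
    · rw [this]; simp; ring
    · intro q hq
      rw [Set.uIcc_of_le hl.le] at hq
      have hp : 0 < l - q + s := by linarith [hq.2]
      rw [abs_of_nonpos (by linarith [hq.2])]
      have h1 : HasDerivAt (fun q => l - q + s) (-1) q := by
        simpa using ((hasDerivAt_id q).const_sub l).add_const s
      have h2 := (h1.log hp.ne').fun_neg
      have h3 : 1 / (-(q - l) + s) = -(-1 / (l - q + s)) := by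
        rw [neg_sub]; ring
      rw [h3]; exact h2
  have e2 : ∫ q in l..M, 1 / (|q - l| + s) = Real.log (M - l + s) - Real.log s := by
    have := intervalIntegral.integral_eq_sub_of_hasDerivAt (a := l) (b := M)
      (f := fun q => Real.log (q - l + s)) (f' := fun q => 1 / (|q - l| + s)) ?_
      (hc.intervalIntegrable _ _)
    · rw [this]; simp
    · intro q hq
      rw [Set.uIcc_of_le hM.le] at hq
      have hp : 0 < q - l + s := by linarith [hq.1]
      rw [abs_of_nonneg (by linarith [hq.1])]
      have h1 : HasDerivAt (fun q => q - l + s) 1 q := by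
        simpa using ((hasDerivAt_id q).sub_const l).add_const s
      exact h1.log hp.ne'
  rw [e1, e2]
  have e3 : Real.log (1 + M / s) = Real.log (M + s) - Real.log s := by
    rw [← Real.log_div (by linarith) hs.ne']
    congr 1; field_simp; ring
  have := Real.log_le_log (show 0 < l - 1 + s by linarith) (show l - 1 + s ≤ M + s by linarith)
  have := Real.log_le_log (show 0 < M - l + s by linarith) (show M - l + s ≤ M + s by linarith)
  linarith

lemma wK_bd (ε₁ ε₃ ε₄ ε₅ ε₆ : ℝ)
    (hε₁ : ε₁ ≤ 1) (hε₁₄ : ε₄ < ε₁) (hε₄ : 0 ≤ ε₄)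
    (hε₅1 : ε₅ < 1) (hε₅ : 0 ≤ ε₅)
    (hε₃₆ : ε₆ < ε₃) (hε₆ : 0 ≤ ε₆)
    (lam₁ lam₂ : ℝ) (hlam₁ : 1 < lam₁) (hlam₂0 : 0 ≤ lam₂) (hlam₂ : lam₂ < 1) (P : ℝ) (hP : 1 ≤ P) :
    ∃ C κ : ℝ, 0 < C ∧ 0 < κ ∧ ∀ q : ℝ, 1 < q →
      (q ≤ 2 * lam₁ → Real.log (1 + (q - 1) * P) ^ 2 / (q - 1) ≤ C) ∧
      (q ≤ 2 * lam₁ → q ≠ lam₁ → Real.log (1 + (q - 1) * P) ^ 2 / (q - 1) *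
         (q ^ ε₄ / |q - 1| ^ ε₁ + q ^ ε₅ / |q - lam₁| + q ^ ε₆ / |q - lam₂| ^ ε₃)
           ≤ C * (1 + 1 / |q - lam₁|)) ∧
      (2 * lam₁ < q → Real.log (1 + (q - 1) * P) ^ 2 / (q - 1) *
         (q ^ ε₄ / |q - 1| ^ ε₁ + q ^ ε₅ / |q - lam₁| + q ^ ε₆ / |q - lam₂| ^ ε₃)
           ≤ C * q ^ (-1 - κ)) := by
  obtain ⟨k, hk, hk1, hk2, hk3⟩ : ∃ k : ℝ, 0 < k ∧ k ≤ ε₁ - ε₄ ∧ k ≤ 1 - ε₅ ∧ k ≤ ε₃ - ε₆ :=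
    ⟨min (ε₁ - ε₄) (min (1 - ε₅) (ε₃ - ε₆)), by
      refine lt_min (by linarith) (lt_min (by linarith) (by linarith)), by simp, by simp, by simp⟩
  set M := 2 * lam₁ with hM
  have hM2 : 2 < M := by linarith
  -- first constants
  set C1 := P ^ 2 * M with hC1
  have hC1p : 0 < C1 := by positivity
  set C2 := P ^ 2 * (M ^ (1 - ε₁) * M ^ ε₄ + M * M ^ ε₅ + M * (M ^ ε₆ / (1 - lam₂) ^ ε₃)) with hC2
  have h1l : 0 < 1 - lam₂ := by linarith
  have hC2p : 0 < C2 := by positivity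
  set C3 := 2 * (P ^ (k / 4) / (k / 4)) ^ 2 * (2 ^ ε₁ + 2 + 2 ^ ε₃) with hC3
  have hC3p : 0 < C3 := by positivity
  refine ⟨C1 + C2 + C3, k / 2, by positivity, by positivity, fun q hq => ?_⟩
  have hq1 : 0 < q - 1 := by linarith
  have hlog0 : 0 ≤ Real.log (1 + (q - 1) * P) := Real.log_nonneg (by nlinarith)
  have hw : Real.log (1 + (q - 1) * P) ^ 2 / (q - 1) ≤ P ^ 2 * (q - 1) := by
    rw [div_le_iff₀ hq1]
    have : Real.log (1 + (q - 1) * P) ≤ (q - 1) * P := by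
      have := Real.log_le_sub_one_of_pos (show 0 < 1 + (q - 1) * P by positivity)
      linarith
    calc _ ≤ ((q - 1) * P) ^ 2 := by gcongr
      _ = _ := by ring
  have hw0 : 0 ≤ Real.log (1 + (q - 1) * P) ^ 2 / (q - 1) := by positivity
  refine ⟨fun hqM => ?_, fun hqM hne => ?_, fun hqM => ?_⟩
  · calc _ ≤ _ := hw
      _ ≤ C1 := by rw [hC1]; gcongr; linarith
      _ ≤ _ := by linarith
  · have hu : 0 < |q - lam₁| := abs_pos.2 (sub_ne_zero.2 hne)
    have hqa : |q - 1| = q - 1 := abs_of_pos hq1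
    have hqb : |q - lam₂| = q - lam₂ := abs_of_pos (by linarith)
    rw [hqa, hqb]
    have hql2 : 0 < q - lam₂ := by linarith
    have t1 : (q - 1) * (q ^ ε₄ / (q - 1) ^ ε₁) ≤ M ^ (1 - ε₁) * M ^ ε₄ := by
      have : (q - 1) * (q ^ ε₄ / (q - 1) ^ ε₁) = (q - 1) ^ (1 - ε₁) * q ^ ε₄ := by
        rw [Real.rpow_sub hq1, Real.rpow_one]; ring
      rw [this]
      gcongr
      linarith
    have t2 : (q - 1) * (q ^ ε₅ / |q - lam₁|) ≤ M * M ^ ε₅ * (1 / |q - lam₁|) := by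
      rw [mul_div_assoc', ← mul_one_div ((q - 1) * q ^ ε₅)]
      gcongr
      linarith
    have t3 : (q - 1) * (q ^ ε₆ / (q - lam₂) ^ ε₃) ≤ M * (M ^ ε₆ / (1 - lam₂) ^ ε₃) := by
      have : 0 ≤ ε₃ := by linarith
      gcongr
      linarith
    calc _ ≤ P ^ 2 * (q - 1) * (q ^ ε₄ / (q - 1) ^ ε₁ + q ^ ε₅ / |q - lam₁| + q ^ ε₆ / (q - lam₂) ^ ε₃) := by
            gcongr
      _ = P ^ 2 * ((q - 1) * (q ^ ε₄ / (q - 1) ^ ε₁) + (q - 1) * (q ^ ε₅ / |q - lam₁|) + (q - 1) * (q ^ ε₆ / (q - lam₂) ^ ε₃)) := by ring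
      _ ≤ P ^ 2 * (M ^ (1 - ε₁) * M ^ ε₄ * (1 + 1 / |q - lam₁|) + M * M ^ ε₅ * (1 + 1 / |q - lam₁|) + M * (M ^ ε₆ / (1 - lam₂) ^ ε₃) * (1 + 1 / |q - lam₁|)) := by
            have hv : 0 < 1 / |q - lam₁| := by positivity
            gcongr ?_ * (?_ + ?_ + ?_)
            · exact t1.trans (le_mul_of_one_le_right (by positivity) (by linarith))
            · refine t2.trans (mul_le_mul_of_nonneg_left (by linarith) (by positivity))
            · exact t3.trans (le_mul_of_one_le_right (by positivity) (by linarith))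
      _ = C2 * (1 + 1 / |q - lam₁|) := by rw [hC2]; ring
      _ ≤ _ := by gcongr; linarith
  · have hq0 : 0 < q := by linarith
    have a1 : q / 2 ≤ |q - 1| := by rw [abs_of_pos hq1]; linarith
    have a2 : q / 2 ≤ |q - lam₁| := (show q / 2 ≤ q - lam₁ by linarith).trans (le_abs_self _)
    have a3 : q / 2 ≤ |q - lam₂| := (show q / 2 ≤ q - lam₂ by linarith).trans (le_abs_self _)
    have gen : ∀ e e' u : ℝ, 0 ≤ e' → k ≤ e' - e → q / 2 ≤ u → q ^ e / u ^ e' ≤ 2 ^ e' * q ^ (-k) := by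
      intro e e' u he' hke hu
      calc q ^ e / u ^ e' ≤ q ^ e / (q / 2) ^ e' := by gcongr
        _ = 2 ^ e' * q ^ (e - e') := by
          rw [Real.div_rpow hq0.le (by norm_num), Real.rpow_sub hq0]; field_simp
        _ ≤ _ := by
          gcongr 2 ^ e' * ?_
          exact Real.rpow_le_rpow_of_exponent_le hq.le (by linarith)
    have b1 := gen ε₄ ε₁ _ (by linarith) hk1 a1
    have b2 := gen ε₅ 1 _ (by linarith) hk2 a2
    have b3 := gen ε₆ ε₃ _ (by linarith) hk3 a3
    rw [Real.rpow_one, Real.rpow_one] at b2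
    have hlog : Real.log (1 + (q - 1) * P) ≤ P ^ (k / 4) / (k / 4) * q ^ (k / 4) := by
      calc _ ≤ Real.log (P * q) := Real.log_le_log (by positivity) (by nlinarith)
        _ ≤ (P * q) ^ (k / 4) / (k / 4) := Real.log_le_rpow_div (by positivity) (by positivity)
        _ = _ := by rw [Real.mul_rpow (by positivity) (by positivity)]; ring
    have hw2 : Real.log (1 + (q - 1) * P) ^ 2 / (q - 1) ≤
        2 * (P ^ (k / 4) / (k / 4)) ^ 2 * q ^ (k / 2 - 1) := by
      calc _ ≤ (P ^ (k / 4) / (k / 4) * q ^ (k / 4)) ^ 2 / (q / 2) := by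
            gcongr; linarith
        _ = 2 * (P ^ (k / 4) / (k / 4)) ^ 2 * ((q ^ (k / 4)) ^ 2 / q) := by field_simp
        _ = _ := by
          rw [Real.rpow_sub hq0, Real.rpow_one, ← Real.rpow_natCast (q ^ (k / 4)), ← Real.rpow_mul hq0.le]
          have : k / 4 * ((2 : ℕ) : ℝ) = k / 2 := by push_cast; ring
          rw [this]
    calc _ ≤ (2 * (P ^ (k / 4) / (k / 4)) ^ 2 * q ^ (k / 2 - 1)) *
          (2 ^ ε₁ * q ^ (-k) + 2 * q ^ (-k) + 2 ^ ε₃ * q ^ (-k)) := by gcongr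
      _ = C3 * (q ^ (k / 2 - 1) * q ^ (-k)) := by rw [hC3]; ring
      _ = C3 * q ^ (-1 - k / 2) := by rw [← Real.rpow_add hq0]; congr 2; ring
      _ ≤ _ := by gcongr; linarith

lemma lim_bd (R M A1 A2 A3 : ℝ) (hM : 0 < M) (ψ : ℝ → ℝ)
    (hψ : Tendsto (fun T : ℝ => ψ T / Real.log T) atTop (nhds 0)) :
    Tendsto (fun T : ℝ => (A1 * ψ T + A2) / Real.log (T - R + 1) ^ 2 *
      (A3 + 2 * Real.log (1 + M * T))) atTop (nhds 0) := by
  have hlog := Real.tendsto_log_atTop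
  have hinv : Tendsto (fun T : ℝ => 1 / Real.log T) atTop (nhds 0) := by
    simp only [one_div]; exact hlog.inv_tendsto_atTop
  -- log of affine over log tends to 1
  have aff : ∀ a b : ℝ, 0 < a → Tendsto (fun T : ℝ => Real.log (a * T + b) / Real.log T) atTop (nhds 1) := by
    intro a b ha
    have h1 : Tendsto (fun T : ℝ => a + b / T) atTop (nhds a) := by
      simpa using (tendsto_const_nhds (x := a)).add (tendsto_const_nhds (x := b) |>.div_atTop tendsto_id)
    have h2 : Tendsto (fun T : ℝ => Real.log (a + b / T)) atTop (nhds (Real.log a)) :=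
      h1.log ha.ne'
    have h3 : Tendsto (fun T : ℝ => Real.log (a + b / T) * (1 / Real.log T) + 1) atTop (nhds 1) := by
      simpa using (h2.mul hinv).add_const 1
    refine h3.congr' ?_
    filter_upwards [eventually_gt_atTop 1, h1.eventually (lt_mem_nhds ha)] with T hT hpos
    have : a * T + b = (a + b / T) * T := by field_simp
    rw [this, Real.log_mul hpos.ne' (by linarith)]
    have := Real.log_pos hT
    field_simp
  have e1 : Tendsto (fun T : ℝ => A1 * (ψ T / Real.log T) + A2 * (1 / Real.log T)) atTop (nhds 0) := by
    simpa using (hψ.const_mul A1).add (hinv.const_mul A2)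
  have e2 : Tendsto (fun T : ℝ => A3 * (1 / Real.log T) + 2 * (Real.log (M * T + 1) / Real.log T)) atTop (nhds 2) := by
    simpa using (hinv.const_mul A3).add ((aff M 1 hM).const_mul 2)
  have e3 : Tendsto (fun T : ℝ => ((Real.log (1 * T + (1 - R)) / Real.log T) ^ 2)⁻¹) atTop (nhds 1) := by
    simpa using ((aff 1 (1 - R) one_pos).pow 2).inv₀ (by norm_num)
  have e4 := (e1.mul e2).mul e3
  simp only [zero_mul] at e4
  refine e4.congr' ?_
  filter_upwards [eventually_gt_atTop 1, eventually_gt_atTop (1 + R)] with T hT hTR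
  have h1 := Real.log_pos hT
  have h2 : 0 < Real.log (T - R + 1) := Real.log_pos (by linarith)
  have e5 : 1 * T + (1 - R) = T - R + 1 := by ring
  rw [e5, add_comm (M * T) 1]
  field_simp

lemma J_bd (R : ℝ) (hR : 0 < R) (Pi : ℝ → ℝ → ℝ)
    (hmeas : Measurable fun p : ℝ × ℝ => Pi p.1 p.2) (c : ℝ) (hc : 0 < c)
    (hbd : ∀ x y : ℝ, R < x → x < y → |Pi x y| ≤ c)
    (T : ℝ) (hT : R < T) (q : ℝ) (hq : 1 < q) (A : ℝ) (hA : 0 ≤ A)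
    (hint : ∀ a, R < a → a ≤ T → |∫ x in a..T, Pi x (q * x)| ≤ A) :
    |∫ x in Set.Ioi R, |phi R T x - phi R T (q * x)| ^ 2 * Pi x (q * x)| ≤
      (Real.log (1 + (q - 1) * max 1 R) / Real.log (T - R + 1)) ^ 2 * (2 * A) ∧
    |∫ x in Set.Ioi R, |phi R T x - phi R T (q * x)| ^ 2 * Pi x (q * x)| ≤
      (Real.log (1 + (q - 1) * max 1 R) / Real.log (T - R + 1)) ^ 2 * (c * T) := by
  have hcut : ∫ x in Set.Ioi R, |phi R T x - phi R T (q * x)| ^ 2 * Pi x (q * x)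
      = ∫ x in Set.Ioc R T, |phi R T x - phi R T (q * x)| ^ 2 * Pi x (q * x) := by
    apply setIntegral_eq_of_subset_of_forall_sdiff_eq_zero measurableSet_Ioi Set.Ioc_subset_Ioi_self
    rintro x ⟨hx1, hx2⟩
    have hx1' : R < x := hx1
    have : T < x := by
      by_contra h
      exact hx2 ⟨hx1', not_lt.1 h⟩
    rw [phi_zero R T x hT this.le, phi_zero R T (q * x) hT (by nlinarith)]
    simp
  rw [hcut]
  have hfm : Measurable (fun x => Pi x (q * x)) :=
    hmeas.comp (measurable_id.prodMk (measurable_id.const_mul q))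
  have hfb : ∀ x, R < x → |Pi x (q * x)| ≤ c := fun x hx => hbd x (q * x) hx (by nlinarith)
  have hfi : IntegrableOn (fun x => Pi x (q * x)) (Set.Ioc R T) := by
    apply Measure.integrableOn_of_bounded (M := c) (by simp) hfm.aestronglyMeasurable
    filter_upwards [ae_restrict_mem measurableSet_Ioc] with x hx
    exact hfb x hx.1
  have hII : ∀ s t, R ≤ s → s ≤ t → t ≤ T → IntervalIntegrable (fun x => Pi x (q * x)) volume s t := by
    intro s t hs hst ht
    rw [intervalIntegrable_iff_integrableOn_Ioc_of_le hst]
    exact hfi.mono_set (Set.Ioc_subset_Ioc hs ht)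
  have hgm : Measurable (fun x => |phi R T x - phi R T (q * x)| ^ 2) := by
    have := phi_meas R T
    have h2 : Measurable (fun x => phi R T (q * x)) := this.comp (measurable_id.const_mul q)
    exact ((this.sub h2).abs).pow_const 2
  have hab : ∀ x, R < x → |phi R T x - phi R T (q * x)| = phi R T x - phi R T (q * x) := fun x hx =>
    abs_of_nonneg (sub_nonneg.2 (phi_anti R T x (q * x) hT hx.le (by nlinarith)))
  have huni : ∀ x y z, R < x → x ≤ y → y ≤ z → z ≤ T →
      min (|phi R T x - phi R T (q * x)| ^ 2) (|phi R T z - phi R T (q * z)| ^ 2)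
        ≤ |phi R T y - phi R T (q * y)| ^ 2 := by
    intro x y z hx hxy hyz hz
    have h1 := h_uni R T q x y z hR hT hx.le hq hxy hyz
    rw [← hab x hx, ← hab y (by linarith), ← hab z (by linarith)] at h1
    rcases min_le_iff.1 h1 with h | h
    · exact min_le_of_left_le (by gcongr)
    · exact min_le_of_right_le (by gcongr)
  have hgB : ∀ x ∈ Set.Ioc R T, |phi R T x - phi R T (q * x)| ^ 2 ≤
      (Real.log (1 + (q - 1) * max 1 R) / Real.log (T - R + 1)) ^ 2 := by
    intro x hx
    have := h_bd R T q x hR hT hx.1.le hq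
    gcongr
  have hA' : ∀ a, R ≤ a → a ≤ T → |∫ x in a..T, Pi x (q * x)| ≤ A := by
    intro a ha haT
    rcases ha.eq_or_lt with h | h
    · subst h
      have hco : ContinuousOn (fun x => ∫ t in x..T, Pi t (q * t)) (Set.uIcc R T) := by
        apply intervalIntegral.continuousOn_primitive_interval_left
        rw [Set.uIcc_of_le hT.le, integrableOn_Icc_iff_integrableOn_Ioc]
        exact hfi
      rw [Set.uIcc_of_le hT.le] at hco
      have h1 := (hco R ⟨le_rfl, hT.le⟩).mono (s := Set.Ioc R T) Set.Ioc_subset_Icc_self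
      have h2 : Tendsto (fun x => |∫ t in x..T, Pi t (q * t)|) (nhdsWithin R (Set.Ioc R T))
        (nhds |∫ t in R..T, Pi t (q * t)|) := h1.tendsto.abs
      have : (nhdsWithin R (Set.Ioc R T)).NeBot := by
        rw [nhdsWithin_Ioc_eq_nhdsGT hT]; infer_instance
      apply le_of_tendsto h2
      filter_upwards [self_mem_nhdsWithin] with x hx
      exact hint x hx.1 hx.2
    · exact hint a h haT
  constructor
  · apply aux_layer _ _ R T (2 * A) _ (by positivity) (by positivity) hfi hgm _
      (fun x _ => by positivity) hgB huni
    intro s t hs hst ht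
    have e := intervalIntegral.integral_add_adjacent_intervals (hII s t hs hst ht)
      (hII t T (by linarith) ht le_rfl)
    have e1 := hA' s hs (by linarith)
    have e2 := hA' t (by linarith) ht
    rw [abs_le] at *
    constructor <;> linarith
  · apply aux_layer _ _ R T (c * T) _ (by have := hR.trans hT; positivity) (by positivity) hfi hgm _
      (fun x _ => by positivity) hgB huni
    intro s t hs hst ht
    have := intervalIntegral.norm_integral_le_of_norm_le_const (a := s) (b := t) (C := c)
      (f := fun x => Pi x (q * x)) (by
        intro x hx
        rw [Set.uIoc_of_le hst] at hx
        exact hfb x (by linarith [hx.1]))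
    rw [Real.norm_eq_abs, abs_of_nonneg (sub_nonneg.2 hst)] at this
    refine this.trans ?_
    gcongr
    linarith

lemma main_bd (R : ℝ) (hR : 0 < R) (Pi : ℝ → ℝ → ℝ)
    (hmeas : Measurable fun p : ℝ × ℝ => Pi p.1 p.2) (T : ℝ) (H : ℝ → ℝ)
    (hH : Integrable H) (hH0 : ∀ q, 0 ≤ H q)
    (hJ : ∀ q, 1 < q → |∫ x in Set.Ioi R, |phi R T x - phi R T (q * x)| ^ 2 * Pi x (q * x)|
       / (q - 1) ≤ H q) :
    |∫ p in {p : ℝ × ℝ | R ≤ p.1 ∧ p.1 ≤ p.2},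
          |phi R T p.1 - phi R T p.2| ^ 2 * (Pi p.1 p.2 / (p.2 - p.1))| ≤ ∫ q, H q := by
  set F : ℝ × ℝ → ℝ := fun p => |phi R T p.1 - phi R T p.2| ^ 2 * (Pi p.1 p.2 / (p.2 - p.1)) with hF
  set D : Set (ℝ × ℝ) := {p : ℝ × ℝ | R ≤ p.1 ∧ p.1 ≤ p.2} with hD
  have hDm : MeasurableSet D :=
    (measurableSet_le measurable_const measurable_fst).inter
      (measurableSet_le measurable_fst measurable_snd)
  have hFm : Measurable F := by
    have h1 : Measurable (fun p : ℝ × ℝ => phi R T p.1) := (phi_meas R T).comp measurable_fst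
    have h2 : Measurable (fun p : ℝ × ℝ => phi R T p.2) := (phi_meas R T).comp measurable_snd
    exact ((h1.sub h2).abs.pow_const 2).mul (hmeas.div (measurable_snd.sub measurable_fst))
  by_cases hI : IntegrableOn F D
  · rw [← integral_indicator hDm]
    obtain ⟨-, h2⟩ := aux_swap (D.indicator F) (hFm.indicator hDm) (hI.integrable_indicator hDm)
    rw [h2]
    rw [← Real.norm_eq_abs]
    apply norm_integral_le_of_norm_le hH
    have hne : ∀ᵐ x : ℝ, x ≠ 1 := by simp [ae_iff]
    filter_upwards [hne] with q hq1
    rcases lt_or_gt_of_ne hq1 with hq | hq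
    · have : ∀ x : ℝ, |x| * D.indicator F (x, x * q) = 0 := by
        intro x
        rw [Set.indicator_of_notMem, mul_zero]
        rintro ⟨h1, h2⟩
        simp only at h1 h2
        nlinarith
      simp [this, hH0]
    · refine le_trans (le_of_eq ?_) (hJ q hq)
      have : ∀ x : ℝ, |x| * D.indicator F (x, x * q) =
          (Set.Ici R).indicator (fun x => |phi R T x - phi R T (q * x)| ^ 2 * Pi x (q * x) / (q - 1)) x := by
        intro x
        by_cases hx : R ≤ x
        · have hxp : 0 < x := by linarith
          rw [Set.indicator_of_mem (show (x, x * q) ∈ D from ⟨hx, by simp only; nlinarith⟩),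
            Set.indicator_of_mem (show x ∈ Set.Ici R from hx), abs_of_pos hxp, mul_comm x q]
          simp only [hF]
          have e : q * x - x = x * (q - 1) := by ring
          have : q - 1 ≠ 0 := by linarith
          rw [e]
          field_simp
        · rw [Set.indicator_of_notMem (fun h => hx h.1), Set.indicator_of_notMem (show x ∉ Set.Ici R from hx), mul_zero]
      simp_rw [this]
      rw [integral_indicator measurableSet_Ici, integral_Ici_eq_integral_Ioi, integral_div,
        norm_div, Real.norm_eq_abs, Real.norm_eq_abs, abs_of_pos (show 0 < q - 1 by linarith)]
  · rw [integral_undef hI, abs_zero]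
    exact integral_nonneg hH0

theorem stmt_3 (R : ℝ) (hR : 0 < R) (Pi : ℝ → ℝ → ℝ)
    (hmeas : Measurable fun p : ℝ × ℝ => Pi p.1 p.2)
    (ε₁ ε₃ ε₄ ε₅ ε₆ : ℝ)
    (hε₁ : ε₁ ≤ 1) (hε₁₄ : ε₄ < ε₁) (hε₄ : 0 ≤ ε₄)
    (hε₅1 : ε₅ < 1) (hε₅ : 0 ≤ ε₅)
    (hε₃₆ : ε₆ < ε₃) (hε₆ : 0 ≤ ε₆)
    (lam₁ lam₂ : ℝ) (hlam₁ : 1 < lam₁) (hlam₂0 : 0 ≤ lam₂) (hlam₂ : lam₂ < 1)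
    (ψ : ℝ → ℝ) (hψpos : ∀ T : ℝ, 0 < T → 0 < ψ T)
    (hψ : Tendsto (fun T : ℝ => ψ T / Real.log T) atTop (nhds 0))
    (c : ℝ) (hc : 0 < c)
    (hint : ∀ lam a b : ℝ, 1 < lam → R < a → R < b →
      |∫ x in a..b, Pi x (lam * x)| ≤
        c * ψ (max a b) *
          (lam ^ ε₄ / |lam - 1| ^ ε₁ + lam ^ ε₅ / |lam - lam₁| +
            lam ^ ε₆ / |lam - lam₂| ^ ε₃))
    (hbd : ∀ x y : ℝ, R < x → x < y → |Pi x y| ≤ c) :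
    Tendsto (fun T : ℝ =>
        ∫ p in {p : ℝ × ℝ | R ≤ p.1 ∧ p.1 ≤ p.2},
          |phi R T p.1 - phi R T p.2| ^ 2 * (Pi p.1 p.2 / (p.2 - p.1)))
      atTop (nhds 0) := by
  obtain ⟨C, κ, hC, hκ, hCK⟩ := wK_bd ε₁ ε₃ ε₄ ε₅ ε₆ hε₁ hε₁₄ hε₄ hε₅1 hε₅ hε₃₆ hε₆ lam₁ lam₂
    hlam₁ hlam₂0 hlam₂ (max 1 R) (le_max_left _ _)
  set M := 2 * lam₁ with hM
  set I3 := ∫ q in Set.Ioi M, q ^ (-1 - κ) with hI3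
  have hlim := lim_bd R M (4 * c * C) (2 * c * C) ((M - 1) + I3) (by linarith) ψ hψ
  refine squeeze_zero_norm' ?_ hlim
  filter_upwards [eventually_gt_atTop R] with T hT
  have hT0 : 0 < T := hR.trans hT
  have hL : 0 < Real.log (T - R + 1) := Real.log_pos (by linarith)
  have hψT := hψpos T hT0
  set L := Real.log (T - R + 1) with hLdef
  set E := (4 * c * C * ψ T + 2 * c * C) / L ^ 2 with hE
  have hE0 : 0 < E := by positivity
  have hs : 0 < 1 / T := by positivity
  obtain ⟨hi1, hi2⟩ := log_int M lam₁ (1 / T) hlam₁ (by linarith) hs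
  have hi0 : IntegrableOn (fun _ : ℝ => (1 : ℝ)) (Set.Ioc 1 M) := by simp
  have hi3 : IntegrableOn (fun q : ℝ => q ^ (-1 - κ)) (Set.Ioi M) :=
    integrableOn_Ioi_rpow_of_lt (by linarith) (by linarith)
  have hi01 : IntegrableOn (fun q : ℝ => 1 + 1 / (|q - lam₁| + 1 / T)) (Set.Ioc 1 M) := hi0.add hi1
  set H1 : ℝ → ℝ := (Set.Ioc 1 M).indicator (fun q : ℝ => 1 + 1 / (|q - lam₁| + 1 / T)) with hH1
  set H2 : ℝ → ℝ := (Set.Ioi M).indicator (fun q : ℝ => q ^ (-1 - κ)) with hH2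
  have hH1i : Integrable H1 := hi01.integrable_indicator measurableSet_Ioc
  have hH2i : Integrable H2 := hi3.integrable_indicator measurableSet_Ioi
  have hH1n : ∀ q, 0 ≤ H1 q := fun q => Set.indicator_nonneg (fun q _ => by positivity) q
  have hH2n : ∀ q, 0 ≤ H2 q := fun q => Set.indicator_nonneg (fun q (hq : M < q) => by
    have : 0 < q := by linarith
    positivity) q
  have hbound := main_bd R hR Pi hmeas T (fun q => E * (H1 q + H2 q)) ((hH1i.add hH2i).const_mul E)
    (fun q => mul_nonneg hE0.le (add_nonneg (hH1n q) (hH2n q))) ?_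
  · refine hbound.trans ?_
    rw [integral_const_mul, integral_add hH1i hH2i]
    apply mul_le_mul_of_nonneg_left _ hE0.le
    have e1 : ∫ q, H1 q = (M - 1) + ∫ q in Set.Ioc 1 M, 1 / (|q - lam₁| + 1 / T) := by
      rw [hH1, integral_indicator measurableSet_Ioc, integral_add hi0 hi1]
      congr 1
      simp [measureReal_def]
      linarith
    have e2 : ∫ q, H2 q = I3 := integral_indicator measurableSet_Ioi
    have e3 : M / (1 / T) = M * T := by field_simp
    rw [e3] at hi2
    linarith
  · intro q hq
    have hq1 : 0 < q - 1 := by linarith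
    set K := q ^ ε₄ / |q - 1| ^ ε₁ + q ^ ε₅ / |q - lam₁| + q ^ ε₆ / |q - lam₂| ^ ε₃ with hK
    have hK0 : 0 ≤ K := by positivity
    obtain ⟨j1, j2⟩ := J_bd R hR Pi hmeas c hc hbd T hT q hq (c * ψ T * K) (by positivity) (by
      intro a ha haT
      have := hint q a T hq ha hT
      rwa [max_eq_right haT] at this)
    set J := |∫ x in Set.Ioi R, |phi R T x - phi R T (q * x)| ^ 2 * Pi x (q * x)| with hJ
    obtain ⟨k1, k2, k3⟩ := hCK q hq
    set w := Real.log (1 + (q - 1) * max 1 R) ^ 2 / (q - 1) with hw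
    have j1' : J / (q - 1) ≤ 2 * c * ψ T / L ^ 2 * (w * K) := by
      calc J / (q - 1) ≤ _ := div_le_div_of_nonneg_right j1 hq1.le
        _ = _ := by rw [hw, div_pow, ← hLdef]; field_simp
    have j2' : J / (q - 1) ≤ c * T / L ^ 2 * w := by
      calc J / (q - 1) ≤ _ := div_le_div_of_nonneg_right j2 hq1.le
        _ = _ := by rw [hw, div_pow, ← hLdef]; field_simp
    have hEa : 4 * c * ψ T / L ^ 2 * C ≤ E := by
      rw [hE, add_div]
      have : 0 < 2 * c * C / L ^ 2 := by positivity
      have e : 4 * c * ψ T / L ^ 2 * C = 4 * c * C * ψ T / L ^ 2 := by ring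
      linarith
    have hEb : 2 * c / L ^ 2 * C ≤ E := by
      rw [hE, add_div]
      have : 0 < 4 * c * C * ψ T / L ^ 2 := by positivity
      have e : 2 * c / L ^ 2 * C = 2 * c * C / L ^ 2 := by ring
      linarith
    rcases le_or_gt q M with hqM | hqM
    · have hv : H1 q + H2 q = 1 + 1 / (|q - lam₁| + 1 / T) := by
        rw [hH1, hH2, Set.indicator_of_mem (show q ∈ Set.Ioc 1 M from ⟨hq, hqM⟩),
          Set.indicator_of_notMem (by simpa using hqM), add_zero]
      simp only [hv]
      rcases le_or_gt (1 / T) |q - lam₁| with hu | hu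
      · have hu0 : 0 < |q - lam₁| := hs.trans_le hu
        have hh := k2 hqM (by intro h; simp [h] at hu0)
        have hinv : 1 / |q - lam₁| ≤ 2 * (1 / (|q - lam₁| + 1 / T)) := by
          rw [mul_one_div, div_le_div_iff₀ hu0 (by positivity)]
          linarith
        have hv0 : 0 < 1 / (|q - lam₁| + 1 / T) := by positivity
        calc J / (q - 1) ≤ _ := j1'
          _ ≤ 2 * c * ψ T / L ^ 2 * (C * (2 * (1 + 1 / (|q - lam₁| + 1 / T)))) := by
            apply mul_le_mul_of_nonneg_left _ (by positivity)
            refine hh.trans ?_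
            gcongr
            linarith
          _ = 4 * c * ψ T / L ^ 2 * C * (1 + 1 / (|q - lam₁| + 1 / T)) := by ring
          _ ≤ _ := by gcongr
      · have hinv : T / 2 ≤ 1 / (|q - lam₁| + 1 / T) := by
          rw [div_le_div_iff₀ (by norm_num) (by positivity)]
          have : T * |q - lam₁| ≤ 1 := by
            rw [lt_div_iff₀ hT0] at hu; linarith
          have : T * (1 / T) = 1 := by field_simp
          linarith
        calc J / (q - 1) ≤ _ := j2'
          _ ≤ c * T / L ^ 2 * C := by gcongr; exact k1 hqM
          _ = 2 * c / L ^ 2 * C * (T / 2) := by ring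
          _ ≤ E * (T / 2) := by gcongr
          _ ≤ _ := by gcongr; linarith
    · have hv : H1 q + H2 q = q ^ (-1 - κ) := by
        rw [hH1, hH2, Set.indicator_of_notMem (fun h => absurd h.2 (not_le.2 hqM)),
          Set.indicator_of_mem (show q ∈ Set.Ioi M from hqM), zero_add]
      simp only [hv]
      have hq0 : 0 < q := by linarith
      have hp : 0 < q ^ (-1 - κ) := by positivity
      calc J / (q - 1) ≤ _ := j1'
        _ ≤ 2 * c * ψ T / L ^ 2 * (C * q ^ (-1 - κ)) := 
          mul_le_mul_of_nonneg_left (k3 hqM) (by positivity)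
        _ ≤ 2 * (2 * c * ψ T / L ^ 2 * (C * q ^ (-1 - κ))) := by
          have : 0 < 2 * c * ψ T / L ^ 2 * (C * q ^ (-1 - κ)) := by positivity
          linarith
        _ = 4 * c * ψ T / L ^ 2 * C * q ^ (-1 - κ) := by ring
        _ ≤ _ := by gcongr
end

section
/- For every x ∈ ℝ, the two-sided limit lim_{R,M→∞} ∫_{−R}^{M} (1/4)·(S(x−y)² − IS(x−y)·S′(x−y)) dy exists and equals 1/2; that is, for every δ > 0 there is N > 0 such that |∫_{−R}^{M} (1/4)·(S(x−y)² − IS(x−y)·S′(x−y)) dy − 1/2| < δ whenever R ≥ N and M ≥ N. (Equivalently, the truncated second correlation function of the symplectic sine process satisfies lim_{R,M→∞} ∫_{−R}^{M} ρ^{(2,T)}_{sine,4}(x,y) dy = −ρ^{(1)}_{sine,4}(x) = −1/2.) -/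
open MeasureTheory Filter

/-- The sine kernel `S(x) = sin(πx)/(πx)` (with `S(0) = 1`). -/
noncomputable def S (t : ℝ) : ℝ :=
  if t = 0 then 1 else Real.sin (Real.pi * t) / (Real.pi * t)

/-- `IS(x) = ∫_0^x S(t) dt`. -/
noncomputable def IS (x : ℝ) : ℝ := ∫ t in (0:ℝ)..x, S t

open scoped FourierTransform Topology

lemma S_eq_sinc (t : ℝ) : S t = Real.sinc (Real.pi * t) := by
  unfold S Real.sinc
  simp [Real.pi_ne_zero]

lemma S_contDiff : ContDiff ℝ 2 S := by
  have hd : Differentiable ℂ (dslope Complex.sin 0) := by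
    rw [← differentiableOn_univ]
    exact (Complex.differentiableOn_dslope Filter.univ_mem).2
      Complex.differentiable_sin.differentiableOn
  have hc : ContDiff ℝ 2 (dslope Complex.sin 0) :=
    (hd.contDiff (n := 2)).restrict_scalars ℝ
  have hS : S = fun t : ℝ => Complex.reCLM (dslope Complex.sin 0
      (Complex.ofRealCLM (Real.pi * t))) := by
    funext t
    unfold S
    split_ifs with h
    · subst h
      simp [dslope_same]
    · have h2 : ((Real.pi * t : ℝ) : ℂ) ≠ 0 := by
        exact_mod_cast mul_ne_zero Real.pi_ne_zero h
      rw [Complex.ofRealCLM_apply, dslope_of_ne _ h2, slope_def_field]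
      simp only [Complex.sin_zero, sub_zero, Complex.reCLM_apply]
      rw [← Complex.ofReal_sin, ← Complex.ofReal_div, Complex.ofReal_re]
  rw [hS]
  exact Complex.reCLM.contDiff.comp (hc.comp (Complex.ofRealCLM.contDiff.comp
    (contDiff_const.mul contDiff_id)))

lemma S_cont : Continuous S := S_contDiff.continuous

lemma S_abs_le_one (t : ℝ) : |S t| ≤ 1 := by
  rw [S_eq_sinc]; exact Real.abs_sinc_le_one _

lemma S_neg (t : ℝ) : S (-t) = S t := by
  rw [S_eq_sinc, S_eq_sinc, mul_neg, Real.sinc_neg]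

lemma S_abs_mul_le (t : ℝ) : |S t| * |t| ≤ 1 := by
  unfold S
  split_ifs with h
  · simp [h]
  · have h1 := Real.abs_sin_le_one (Real.pi * t)
    have h0 : 0 < |t| := abs_pos.2 h
    have hpi := Real.pi_gt_three
    rw [abs_div, abs_mul, abs_of_pos Real.pi_pos, div_mul_eq_mul_div, div_le_one (by positivity)]
    nlinarith

lemma S_sq_integrable : Integrable (fun t => S t ^ 2) := by
  refine (integrable_inv_one_add_sq.const_mul 2).mono'
    (S_cont.pow 2).aestronglyMeasurable ?_
  filter_upwards with t
  have h1 := S_abs_le_one t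
  have h2 := S_abs_mul_le t
  have h3 : S t ^ 2 ≤ 1 := by rw [← sq_abs]; nlinarith [abs_nonneg (S t)]
  have h4 : S t ^ 2 * t ^ 2 ≤ 1 := by
    rw [← sq_abs, ← sq_abs t, ← mul_pow]
    have : 0 ≤ |S t| * |t| := by positivity
    nlinarith
  rw [Real.norm_eq_abs, abs_of_nonneg (sq_nonneg _), ← div_eq_mul_inv, le_div_iff₀ (by positivity)]
  linarith

/-- the triangle function -/
noncomputable def tri (v : ℝ) : ℂ := ((max 0 (1 - |v|) : ℝ) : ℂ)

lemma tri_cont : Continuous tri := by unfold tri; fun_prop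

lemma tri_zero_of {v : ℝ} (h : v ∉ Set.Ioc (-1 : ℝ) 1) : tri v = 0 := by
  unfold tri
  have : 1 - |v| ≤ 0 := by
    by_contra hc
    push Not at hc
    have := abs_lt.1 (show |v| < 1 by linarith)
    exact h ⟨this.1, this.2.le⟩
  rw [max_eq_left this]; simp

lemma tri_integrable : Integrable tri := by
  apply tri_cont.integrable_of_hasCompactSupport
  refine HasCompactSupport.intro (isCompact_Icc (a := (-1:ℝ)) (b := 1)) ?_
  intro v hv
  exact tri_zero_of (fun h => hv ⟨h.1.le, h.2⟩)

lemma tri_fourier (w : ℝ) (hw : w ≠ 0) : 𝓕 tri w = ((S w ^ 2 : ℝ) : ℂ) := by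
  rw [Real.fourier_real_eq_integral_exp_smul]
  set c : ℂ := ((-2 * Real.pi * w : ℝ) : ℂ) * Complex.I with hc
  have hc0 : c ≠ 0 := by
    rw [hc]
    have : (-2 * Real.pi * w : ℝ) ≠ 0 := by simp [Real.pi_ne_zero, hw]
    exact mul_ne_zero (by exact_mod_cast this) Complex.I_ne_zero
  have e1 : ∀ v : ℝ, Complex.exp (((-2 * Real.pi * v * w : ℝ) : ℂ) * Complex.I) • tri v
      = Complex.exp (c * v) * tri v := by
    intro v
    rw [smul_eq_mul, hc]
    congr 2
    push_cast; ring
  simp_rw [e1]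
  have e2 : ∫ v : ℝ, Complex.exp (c * v) * tri v
      = ∫ v in (-1:ℝ)..1, Complex.exp (c * v) * tri v := by
    rw [intervalIntegral.integral_of_le (by norm_num)]
    rw [setIntegral_eq_integral_of_forall_compl_eq_zero]
    intro v hv
    rw [tri_zero_of hv, mul_zero]
  have hcont : Continuous fun v : ℝ => Complex.exp (c * v) * tri v := by
    have := tri_cont
    fun_prop
  rw [e2, ← intervalIntegral.integral_add_adjacent_intervals (b := 0)
    (hcont.intervalIntegrable _ _) (hcont.intervalIntegrable _ _)]
  have hexp : ∀ v : ℝ, HasDerivAt (fun v : ℝ => Complex.exp (c * v)) (Complex.exp (c * v) * c) v := by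
    intro v
    have := ((hasDerivAt_id v).ofReal_comp.const_mul c).cexp
    simpa using this
  have hid : ∀ v : ℝ, HasDerivAt (fun v : ℝ => (v : ℂ)) 1 v := fun v => by
    simpa using (hasDerivAt_id v).ofReal_comp
  have i1 : ∫ v in (-1:ℝ)..0, Complex.exp (c * v) * tri v
      = 1 / c - 1 / c ^ 2 + Complex.exp (-c) / c ^ 2 := by
    have : ∫ v in (-1:ℝ)..0, Complex.exp (c * v) * tri v
        = ∫ v in (-1:ℝ)..0, Complex.exp (c * v) * (1 + v) := by
      apply intervalIntegral.integral_congr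
      intro v hv
      rw [Set.uIcc_of_le (by norm_num)] at hv
      simp only [tri]
      rw [abs_of_nonpos hv.2, max_eq_right (by linarith [hv.1])]
      push_cast; ring
    rw [this, intervalIntegral.integral_eq_sub_of_hasDerivAt
      (f := fun v : ℝ => Complex.exp (c * v) * (1 + v) / c - Complex.exp (c * v) / c ^ 2)]
    · simp
    · intro v _
      have := (((hexp v).mul ((hid v).const_add 1)).div_const c).sub ((hexp v).div_const (c ^ 2))
      refine HasDerivAt.congr_deriv this ?_
      field_simp
      ring
    · apply Continuous.intervalIntegrable; fun_prop
  have i2 : ∫ v in (0:ℝ)..1, Complex.exp (c * v) * tri v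
      = Complex.exp c / c ^ 2 - 1 / c - 1 / c ^ 2 := by
    have : ∫ v in (0:ℝ)..1, Complex.exp (c * v) * tri v
        = ∫ v in (0:ℝ)..1, Complex.exp (c * v) * (1 - v) := by
      apply intervalIntegral.integral_congr
      intro v hv
      rw [Set.uIcc_of_le (by norm_num)] at hv
      simp only [tri]
      rw [abs_of_nonneg hv.1, max_eq_right (by linarith [hv.2])]
      push_cast; ring
    rw [this, intervalIntegral.integral_eq_sub_of_hasDerivAt
      (f := fun v : ℝ => Complex.exp (c * v) * (1 - v) / c + Complex.exp (c * v) / c ^ 2)]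
    · simp; ring
    · intro v _
      have := (((hexp v).mul ((hid v).const_sub 1)).div_const c).add ((hexp v).div_const (c ^ 2))
      refine HasDerivAt.congr_deriv this ?_
      field_simp
      ring
    · apply Continuous.intervalIntegrable; fun_prop
  rw [i1, i2]
  have hS : S w ^ 2 = (2 - 2 * Real.cos (2 * (Real.pi * w))) / (4 * Real.pi ^ 2 * w ^ 2) := by
    unfold S
    rw [if_neg hw, Real.cos_two_mul, Real.cos_sq', div_pow]
    field_simp
    ring
  have hcc : Complex.exp c + Complex.exp (-c) = ((2 * Real.cos (2 * (Real.pi * w)) : ℝ) : ℂ) := by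
    push_cast
    rw [Complex.two_cos, hc]
    push_cast
    rw [add_comm]
    congr 2 <;> ring
  have hc2 : c ^ 2 = -((4 * Real.pi ^ 2 * w ^ 2 : ℝ) : ℂ) := by
    rw [hc, mul_pow, Complex.I_sq]; push_cast; ring
  have : 1 / c - 1 / c ^ 2 + Complex.exp (-c) / c ^ 2 + (Complex.exp c / c ^ 2 - 1 / c - 1 / c ^ 2)
      = (Complex.exp c + Complex.exp (-c) - 2) / c ^ 2 := by ring
  rw [this, hcc, hc2, hS, div_neg, ← neg_div]
  push_cast
  ring

lemma S_sq_integral : ∫ t, S t ^ 2 = 1 := by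
  have hae : (fun w => ((S w ^ 2 : ℝ) : ℂ)) =ᵐ[volume] 𝓕 tri := by
    have : ∀ᵐ w : ℝ, w ≠ 0 := by simp [ae_iff]
    filter_upwards [this] with w hw
    exact (tri_fourier w hw).symm
  have hi : Integrable (𝓕 tri) := S_sq_integrable.ofReal.congr hae
  have h := tri_integrable.fourierInv_fourier_eq hi (v := 0) tri_cont.continuousAt
  rw [Real.fourierInv_eq'] at h
  simp only [inner_zero_right, mul_zero, Complex.ofReal_zero, zero_mul, Complex.exp_zero,
    one_smul] at h
  rw [← integral_congr_ae hae, integral_complex_ofReal] at h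
  simpa [tri] using h

lemma IS_neg (t : ℝ) : IS (-t) = - IS t := by
  unfold IS
  have := intervalIntegral.integral_comp_neg (a := 0) (b := t) S
  simp only [S_neg, neg_zero] at this
  rw [this, intervalIntegral.integral_symm]

lemma IS_abs_le {t : ℝ} (ht : 0 < t) : |IS t| ≤ √t := by
  have hs : 0 < √t := Real.sqrt_pos.2 ht
  have hss : √t * √t = t := Real.mul_self_sqrt ht.le
  have h1 : ∫ u in (0:ℝ)..t, S u ^ 2 ≤ 1 := by
    rw [intervalIntegral.integral_of_le ht.le, ← S_sq_integral]
    exact setIntegral_le_integral S_sq_integrable (Eventually.of_forall fun _ => sq_nonneg _)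
  have hsq : Continuous fun u => S u ^ 2 := S_cont.pow 2
  unfold IS
  calc |∫ u in (0:ℝ)..t, S u| ≤ ∫ u in (0:ℝ)..t, |S u| :=
        intervalIntegral.abs_integral_le_integral_abs ht.le
    _ ≤ ∫ u in (0:ℝ)..t, (√t / 2 * S u ^ 2 + 1 / (2 * √t)) := by
        apply intervalIntegral.integral_mono_on ht.le
        · exact S_cont.abs.intervalIntegrable _ _
        · apply Continuous.intervalIntegrable; fun_prop
        · intro u _
          rw [← sq_abs (S u)]
          have : √t / 2 * |S u| ^ 2 + 1 / (2 * √t) - |S u| = (√t * |S u| - 1) ^ 2 / (2 * √t) := by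
            field_simp
            ring
          have : 0 ≤ (√t * |S u| - 1) ^ 2 / (2 * √t) := by positivity
          linarith
    _ = √t / 2 * (∫ u in (0:ℝ)..t, S u ^ 2) + t * (1 / (2 * √t)) := by
        rw [intervalIntegral.integral_add, intervalIntegral.integral_const_mul,
          intervalIntegral.integral_const]
        · simp
        · apply Continuous.intervalIntegrable; fun_prop
        · apply Continuous.intervalIntegrable; fun_prop
    _ ≤ √t / 2 * 1 + √t / 2 := by
        have : t * (1 / (2 * √t)) = √t / 2 := by
          field_simp; linarith
        rw [this]
        gcongr
    _ = √t := by ring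

lemma ISS_top : Tendsto (fun t => IS t * S t) atTop (𝓝 0) := by
  have h0 : Tendsto (fun t : ℝ => (√t)⁻¹) atTop (𝓝 0) :=
    tendsto_inv_atTop_zero.comp Real.tendsto_sqrt_atTop
  refine squeeze_zero_norm' ?_ h0
  filter_upwards [eventually_gt_atTop 0] with t ht
  have h1 := IS_abs_le ht
  have h2 := S_abs_mul_le t
  rw [abs_of_pos ht] at h2
  have hs : 0 < √t := Real.sqrt_pos.2 ht
  have hss : √t * √t = t := Real.mul_self_sqrt ht.le
  rw [norm_mul, Real.norm_eq_abs, Real.norm_eq_abs, ← one_div, le_div_iff₀ hs]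
  calc |IS t| * |S t| * √t ≤ √t * |S t| * √t := by gcongr
    _ = |S t| * t := by rw [← hss]; ring_nf; rw [Real.sqrt_sq (Real.sqrt_nonneg _)]
    _ ≤ 1 := h2

lemma ISS_bot : Tendsto (fun t => IS t * S t) atBot (𝓝 0) := by
  have := (ISS_top.comp tendsto_neg_atBot_atTop).neg
  simp only [neg_zero] at this
  refine this.congr fun t => ?_
  simp only [Function.comp, IS_neg, S_neg]
  ring

lemma int_formula (a b : ℝ) :
    ∫ u in a..b, (1/4) * (S u ^ 2 - IS u * deriv S u)
      = (1/4) * (2 * (∫ u in a..b, S u ^ 2) - (IS b * S b - IS a * S a)) := by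
  have hIS : ∀ u, HasDerivAt IS (S u) u := fun u =>
    intervalIntegral.integral_hasDerivAt_right (S_cont.intervalIntegrable _ _)
      S_cont.aestronglyMeasurable.stronglyMeasurableAtFilter S_cont.continuousAt
  have hSd : ∀ u, HasDerivAt S (deriv S u) u := fun u =>
    (S_contDiff.differentiable (by norm_num) u).hasDerivAt
  have hdc : Continuous (deriv S) := S_contDiff.continuous_deriv (by norm_num)
  have hISc : Continuous IS := continuous_iff_continuousAt.2 fun u => (hIS u).continuousAt
  have hp := intervalIntegral.integral_mul_deriv_eq_deriv_mul (a := a) (b := b)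
    (fun u _ => hIS u) (fun u _ => hSd u) (S_cont.intervalIntegrable _ _)
    (hdc.intervalIntegrable _ _)
  have hq : ∫ u in a..b, (S u ^ 2 - IS u * deriv S u)
      = (∫ u in a..b, S u ^ 2) - ∫ u in a..b, IS u * deriv S u :=
    intervalIntegral.integral_sub
      ((S_cont.pow 2).intervalIntegrable _ _) ((hISc.mul hdc).intervalIntegrable _ _)
  rw [intervalIntegral.integral_const_mul, hq, hp]
  simp_rw [← pow_two]
  ring

theorem stmt_15 (x : ℝ) :
    ∀ δ : ℝ, 0 < δ → ∃ N : ℝ, 0 < N ∧ ∀ R M : ℝ, N ≤ R → N ≤ M →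
      |(∫ y in (-R)..M, (1/4) * (S (x - y) ^ 2 - IS (x - y) * deriv S (x - y))) - 1/2|
        < δ := by
  intro δ hδ
  have hb : Tendsto (fun p : ℝ × ℝ => x + p.1) (atTop ×ˢ atTop) atTop :=
    tendsto_atTop_add_const_left _ _ tendsto_fst
  have ha : Tendsto (fun p : ℝ × ℝ => x - p.2) (atTop ×ˢ atTop) atBot := by
    simp_rw [sub_eq_add_neg]
    exact tendsto_atBot_add_const_left _ _ (tendsto_neg_atTop_atBot.comp tendsto_snd)
  have h1 := intervalIntegral_tendsto_integral S_sq_integrable ha hb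
  rw [S_sq_integral] at h1
  have h2 := ((h1.const_mul 2).sub ((ISS_top.comp hb).sub (ISS_bot.comp ha))).const_mul (1/4)
  have h3 := Metric.tendsto_nhds.1 h2 δ hδ
  rw [prod_atTop_atTop_eq] at h3
  obtain ⟨⟨N1, N2⟩, hN⟩ := eventually_atTop.1 h3
  refine ⟨max 1 (max N1 N2), by positivity, fun R M hR hM => ?_⟩
  have h4 := hN (R, M) ⟨(le_max_left _ _).trans ((le_max_right _ _).trans hR),
    (le_max_right _ _).trans ((le_max_right _ _).trans hM)⟩
  rw [intervalIntegral.integral_comp_sub_left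
    (fun u => (1/4) * (S u ^ 2 - IS u * deriv S u)) x, int_formula, sub_neg_eq_add]
  rw [Real.dist_eq] at h4
  have e : (1 / 4 * (2 * 1 - (0 - 0)) : ℝ) = 1 / 2 := by norm_num
  rw [e] at h4
  exact h4
end
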